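/- Upper bound on negative-order Renyi divergences between thermal states (via the log-sum inequality): Let n ≥ 1, E : Fin n → ℝ, β_S ≥ β reals, α > 0, and let Emax be an upper bound with E i ≤ Emax for all i. Then (1/(1 + α)) · Real.log (Σ_i (ω β_S i)^(−α) · (ω β i)^(1+α)) ≤ (α/(1 + α)) · (Real.log (Z β_S) − Real.log (Z β) + (β_S − β) · Emax). -/

import Mathlib

/-- Partition function of energies `E` at inverse temperature `t`. -/
noncomputable def Zf {n : ℕ} (E : Fin n → ℝ) (t : ℝ) : ℝ := ∑ i, Real.exp (-t * E i)

/-- Gibbs distribution of energies `E` at inverse temperature `t`. -/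
noncomputable def gibbs {n : ℕ} (E : Fin n → ℝ) (t : ℝ) (i : Fin n) : ℝ :=
  Real.exp (-t * E i) / Zf E t

theorem Zf_pos {n : ℕ} (hn : 1 ≤ n) (E : Fin n → ℝ) (t : ℝ) : 0 < Zf E t :=
  Finset.sum_pos (fun _ _ => Real.exp_pos _) ⟨⟨0, hn⟩, Finset.mem_univ _⟩

theorem gibbs_eq_exp {n : ℕ} (hn : 1 ≤ n) (E : Fin n → ℝ) (t : ℝ) (i : Fin n) :
    gibbs E t i = Real.exp (-t * E i - Real.log (Zf E t)) := by
  rw [Real.exp_sub, Real.exp_log (Zf_pos hn E t), gibbs]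

theorem sum_gibbs {n : ℕ} (hn : 1 ≤ n) (E : Fin n → ℝ) (t : ℝ) :
    ∑ i, gibbs E t i = 1 := by
  simp only [gibbs]
  rw [← Finset.sum_div]
  exact div_self (Zf_pos hn E t).ne'

theorem gibbs_rpow_mul_rpow_le {n : ℕ} (hn : 1 ≤ n) (E : Fin n → ℝ) {β βS : ℝ} (h : β ≤ βS)
    {α : ℝ} (hα : 0 ≤ α) {Emax : ℝ} {i : Fin n} (hi : E i ≤ Emax) :
    gibbs E βS i ^ (-α) * gibbs E β i ^ (1 + α) ≤
      Real.exp (α * (Real.log (Zf E βS) - Real.log (Zf E β) + (βS - β) * Emax)) *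
        gibbs E β i := by
  simp only [gibbs_eq_exp hn]
  rw [← Real.exp_mul, ← Real.exp_mul, ← Real.exp_add, ← Real.exp_add, Real.exp_le_exp]
  have hE : α * ((βS - β) * E i) ≤ α * ((βS - β) * Emax) :=
    mul_le_mul_of_nonneg_left (mul_le_mul_of_nonneg_left hi (sub_nonneg.2 h)) hα
  linarith

theorem negative_renyi_upper_bound_thermal (n : ℕ) (hn : 1 ≤ n) (E : Fin n → ℝ)
    (β βS : ℝ) (h : β ≤ βS) (α : ℝ) (hα : 0 < α)
    (Emax : ℝ) (hEmax : ∀ i, E i ≤ Emax) :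
    (1 / (1 + α)) * Real.log (∑ i, gibbs E βS i ^ (-α) * gibbs E β i ^ (1 + α)) ≤
      (α / (1 + α)) * (Real.log (Zf E βS) - Real.log (Zf E β) + (βS - β) * Emax) := by
  have hpos : 0 < ∑ i, gibbs E βS i ^ (-α) * gibbs E β i ^ (1 + α) :=
    Finset.sum_pos (fun i _ => by simp only [gibbs_eq_exp hn]; positivity)
      ⟨⟨0, hn⟩, Finset.mem_univ _⟩
  have hsum := Finset.sum_le_sum fun i (_ : i ∈ Finset.univ) =>
    gibbs_rpow_mul_rpow_le hn E h hα.le (hEmax i)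
  rw [← Finset.mul_sum, sum_gibbs hn, mul_one] at hsum
  have hlog := (Real.log_le_iff_le_exp hpos).2 hsum
  calc _ ≤ 1 / (1 + α) *
        (α * (Real.log (Zf E βS) - Real.log (Zf E β) + (βS - β) * Emax)) := by gcongr
    _ = _ := by ring
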